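/- Let n ≥ 2 and let D be a torsion-free affine connection on ℝⁿ preserving a volume form. The Thomas cone connection is independent of the choice of scale: let f : ℝⁿ → ℝ be smooth, let D' be the projectively related connection with Christoffel symbols Γ'^C_{AB} = Γ^C_{AB} + δ^C_A ∂_B f + δ^C_B ∂_A f, Ric' its Ricci curvature, and Γ̂' the Thomas cone coefficients built from (Γ', Ric'). Let ψ : C → C be the diffeomorphism ψ(x^0, x) = (e^{−f(x)} x^0, x) of C = ℝ_{>0} × ℝⁿ. Then Γ̂ and Γ̂' are ψ-related, i.e. for all points u ∈ C and all indices i, j, c (running over 0 and Fin n): ∑_{a,b} Γ̂'^c_{ab}(ψ(u)) ∂_i ψ^a(u) ∂_j ψ^b(u) + ∂_i ∂_j ψ^c(u) = ∑_k Γ̂^k_{ij}(u) ∂_k ψ^c(u). -/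

import Mathlib

open scoped BigOperators

/-- Partial derivative of a function on `ι → ℝ` in coordinate direction `i`. -/
noncomputable def pd {ι : Type} [Fintype ι] [DecidableEq ι] (i : ι)
    (f : (ι → ℝ) → ℝ) (x : ι → ℝ) : ℝ :=
  fderiv ℝ f x (Pi.single i 1)

/-- Ricci curvature of an affine connection given by coefficients `Γ k i j`. -/
noncomputable def ricConn {ι : Type} [Fintype ι] [DecidableEq ι]
    (Γ : ι → ι → ι → (ι → ℝ) → ℝ) (i j : ι) (x : ι → ℝ) : ℝ :=
  (∑ k, pd k (fun y => Γ k i j y) x) - (∑ k, pd i (fun y => Γ k k j y) x)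
    + ∑ k, ∑ l, (Γ k k l x * Γ l i j x - Γ k i l x * Γ l k j x)

/-- Levi-Civita Christoffel symbols of a metric in coordinates. -/
noncomputable def christoffel {ι : Type} [Fintype ι] [DecidableEq ι]
    (G : (ι → ℝ) → Matrix ι ι ℝ) (k i j : ι) (x : ι → ℝ) : ℝ :=
  (1/2) * ∑ l, (G x)⁻¹ k l *
    (pd i (fun y => G y j l) x + pd j (fun y => G y i l) x - pd l (fun y => G y i j) x)

/-- Laplacian of a metric in coordinates, applied to a function. -/
noncomputable def laplacian {ι : Type} [Fintype ι] [DecidableEq ι]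
    (G : (ι → ℝ) → Matrix ι ι ℝ) (F : (ι → ℝ) → ℝ) (x : ι → ℝ) : ℝ :=
  ∑ i, ∑ j, (G x)⁻¹ i j *
    (pd i (fun y => pd j F y) x - ∑ k, christoffel G k i j x * pd k F x)

/-- Lie derivative of a metric along a vector field, in coordinates. -/
noncomputable def lieDeriv {ι : Type} [Fintype ι] [DecidableEq ι]
    (X : ι → (ι → ℝ) → ℝ) (G : (ι → ℝ) → Matrix ι ι ℝ) (i j : ι) (x : ι → ℝ) : ℝ :=
  (∑ k, X k x * pd k (fun y => G y i j) x)
  + (∑ k, pd i (X k) x * G x k j) + ∑ k, pd j (X k) x * G x i k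

/-- Index type for the ambient space: `t`, `x^A`, `p_A`, `ρ`. -/
abbrev AmbIdx (n : ℕ) : Type := Unit ⊕ (Fin n ⊕ (Fin n ⊕ Unit))

def it (n : ℕ) : AmbIdx n := Sum.inl ()
def ix {n : ℕ} (A : Fin n) : AmbIdx n := Sum.inr (Sum.inl A)
def ip {n : ℕ} (A : Fin n) : AmbIdx n := Sum.inr (Sum.inr (Sum.inl A))
def irho (n : ℕ) : AmbIdx n := Sum.inr (Sum.inr (Sum.inr ()))

/-- The `x`-coordinates of an ambient point. -/
def xc {n : ℕ} (u : AmbIdx n → ℝ) : Fin n → ℝ := fun A => u (ix A)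

/-- The ambient metric of the affine connection `Γ`. -/
noncomputable def ambientMetric (n : ℕ) (Γ : Fin n → Fin n → Fin n → (Fin n → ℝ) → ℝ)
    (u : AmbIdx n → ℝ) : Matrix (AmbIdx n) (AmbIdx n) ℝ :=
  Matrix.of fun a b =>
    match a, b with
    | Sum.inl _, Sum.inl _ => 2 * u (irho n)
    | Sum.inl _, Sum.inr (Sum.inr (Sum.inr _)) => u (it n)
    | Sum.inr (Sum.inr (Sum.inr _)), Sum.inl _ => u (it n)
    | Sum.inr (Sum.inl A), Sum.inr (Sum.inr (Sum.inl B)) =>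
        (u (it n))^2 * (if A = B then (1:ℝ) else 0)
    | Sum.inr (Sum.inr (Sum.inl A)), Sum.inr (Sum.inl B) =>
        (u (it n))^2 * (if A = B then (1:ℝ) else 0)
    | Sum.inr (Sum.inl A), Sum.inr (Sum.inl B) =>
        (u (it n))^2 * (-2 * ∑ C, u (ip C) * Γ C A B (xc u)
          + (2 * u (irho n) / ((n:ℝ) - 1)) * ricConn Γ A B (xc u))
    | _, _ => 0

/-- The Patterson–Walker metric of a torsion-free affine connection with
coefficients `Γ`, on the doubled space with coordinates `(x, y)`. -/
noncomputable def pwGen {ι : Type} [Fintype ι] [DecidableEq ι]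
    (Γ : ι → ι → ι → (ι → ℝ) → ℝ) (u : (ι ⊕ ι) → ℝ) : Matrix (ι ⊕ ι) (ι ⊕ ι) ℝ :=
  Matrix.of fun a b =>
    match a, b with
    | Sum.inl i, Sum.inl j => -2 * ∑ k, u (Sum.inr k) * Γ k i j (fun l => u (Sum.inl l))
    | Sum.inl i, Sum.inr j => if i = j then (1:ℝ) else 0
    | Sum.inr i, Sum.inl j => if i = j then (1:ℝ) else 0
    | Sum.inr _, Sum.inr _ => 0

/-- `D` preserves a volume form: there is a smooth positive `v` with
`∑_C Γ^C_{AC} = ∂_A (log v)`. -/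
def PreservesVolume (n : ℕ) (Γ : Fin n → Fin n → Fin n → (Fin n → ℝ) → ℝ) : Prop :=
  ∃ v : (Fin n → ℝ) → ℝ, ContDiff ℝ (⊤ : ℕ∞) v ∧ (∀ x, 0 < v x) ∧
    ∀ (A : Fin n) (x : Fin n → ℝ), (∑ C, Γ C A C x) = pd A (fun y => Real.log (v y)) x

/-- Index type for the Thomas cone: `x^0` and `x^A`. -/
abbrev ThIdx (n : ℕ) : Type := Unit ⊕ Fin n

/-- The Thomas cone connection of the affine connection `Γ`. -/
noncomputable def thomasConn (n : ℕ) (Γ : Fin n → Fin n → Fin n → (Fin n → ℝ) → ℝ) :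
    ThIdx n → ThIdx n → ThIdx n → ((ThIdx n) → ℝ) → ℝ := fun c a b u =>
  match c, a, b with
  | Sum.inr C, Sum.inr A, Sum.inr B => Γ C A B (fun E => u (Sum.inr E))
  | Sum.inl _, Sum.inr A, Sum.inr B =>
      -(u (Sum.inl ()) / ((n:ℝ) - 1)) * ricConn Γ A B (fun E => u (Sum.inr E))
  | Sum.inr B, Sum.inr A, Sum.inl _ => if A = B then 1 / u (Sum.inl ()) else 0
  | Sum.inr B, Sum.inl _, Sum.inr A => if A = B then 1 / u (Sum.inl ()) else 0
  | _, _, _ => 0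

/-- The projectively related connection `Γ'^C_{AB} = Γ^C_{AB} + δ^C_A ∂_B f + δ^C_B ∂_A f`. -/
noncomputable def projChange (n : ℕ) (Γ : Fin n → Fin n → Fin n → (Fin n → ℝ) → ℝ)
    (f : (Fin n → ℝ) → ℝ) : Fin n → Fin n → Fin n → (Fin n → ℝ) → ℝ :=
  fun C A B x => Γ C A B x + (if C = A then pd B f x else 0) + (if C = B then pd A f x else 0)

/-- The rescaling diffeomorphism `ψ(x^0, x) = (e^{-f(x)} x^0, x)` of the cone. -/
noncomputable def coneRescale (n : ℕ) (f : (Fin n → ℝ) → ℝ)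
    (u : ThIdx n → ℝ) : ThIdx n → ℝ := fun a =>
  match a with
  | Sum.inl _ => Real.exp (-(f (fun E => u (Sum.inr E)))) * u (Sum.inl ())
  | Sum.inr A => u (Sum.inr A)

section PartialDerivatives

variable {ι : Type} [Fintype ι] [DecidableEq ι] {f g : (ι → ℝ) → ℝ} {x : ι → ℝ}

theorem pd_add (i : ι) (hf : DifferentiableAt ℝ f x) (hg : DifferentiableAt ℝ g x) :
    pd i (fun y => f y + g y) x = pd i f x + pd i g x := by
  simp [pd, fderiv_fun_add hf hg]

theorem pd_neg (i : ι) : pd i (fun y => -f y) x = -pd i f x := by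
  simp [pd, fderiv_fun_neg]

theorem pd_mul (i : ι) (hf : DifferentiableAt ℝ f x) (hg : DifferentiableAt ℝ g x) :
    pd i (fun y => f y * g y) x = f x * pd i g x + g x * pd i f x := by
  simp [pd, fderiv_fun_mul hf hg]

theorem pd_exp (i : ι) (hf : DifferentiableAt ℝ f x) :
    pd i (fun y => Real.exp (f y)) x = Real.exp (f x) * pd i f x := by
  simp [pd, fderiv_exp hf]

theorem pd_const (i : ι) (c : ℝ) : pd i (fun _ => c) x = 0 := by
  simp [pd]

theorem pd_coord (i j : ι) : pd i (fun y => y j) x = if j = i then 1 else 0 := by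
  have h : fderiv ℝ (fun y : ι → ℝ => y j) x = ContinuousLinearMap.proj j :=
    (ContinuousLinearMap.proj (R := ℝ) (φ := fun _ : ι => ℝ) j).fderiv
  simp [pd, h, Pi.single_apply]

theorem pd_ite (i : ι) (p : Prop) [Decidable p] :
    pd i (fun y => if p then f y else 0) x = if p then pd i f x else 0 := by
  split_ifs <;> simp [pd_const]

theorem ContDiff.pd_of_top (i : ι) (hf : ContDiff ℝ (⊤ : ℕ∞) f) :
    ContDiff ℝ (⊤ : ℕ∞) (fun y => pd i f y) :=
  (hf.fderiv_right (m := (⊤ : ℕ∞)) (by simp)).clm_apply contDiff_const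

theorem pd_pd_eq_fderiv_fderiv (i j : ι) (hf : ContDiff ℝ (⊤ : ℕ∞) f) :
    pd i (fun y => pd j f y) x = fderiv ℝ (fderiv ℝ f) x (Pi.single i 1) (Pi.single j 1) := by
  have h : DifferentiableAt ℝ (fderiv ℝ f) x :=
    ((hf.fderiv_right (m := (⊤ : ℕ∞)) (by simp)).differentiable (by simp)) x
  simp only [pd]
  rw [fderiv_clm_apply h (differentiableAt_const _)]
  simp

theorem pd_comm (i j : ι) (hf : ContDiff ℝ (⊤ : ℕ∞) f) :
    pd i (fun y => pd j f y) x = pd j (fun y => pd i f y) x := by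
  rw [pd_pd_eq_fderiv_fderiv i j hf, pd_pd_eq_fderiv_fderiv j i hf]
  have h : ContDiffAt ℝ 2 f x := (contDiff_infty.1 hf 2).contDiffAt
  exact h.isSymmSndFDerivAt (by simp) _ _

end PartialDerivatives

section ConeProjection

variable {n : ℕ} {g : (Fin n → ℝ) → ℝ} {u : ThIdx n → ℝ}

/-- The projection of the cone to its base. -/
noncomputable def coneProj (n : ℕ) : (ThIdx n → ℝ) →L[ℝ] (Fin n → ℝ) :=
  ContinuousLinearMap.pi fun E => ContinuousLinearMap.proj (Sum.inr E)

theorem differentiableAt_comp_coneProj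
    (hg : DifferentiableAt ℝ g (fun E => u (Sum.inr E))) :
    DifferentiableAt ℝ (fun w : ThIdx n → ℝ => g (fun E => w (Sum.inr E))) u :=
  DifferentiableAt.comp (f := coneProj n) u hg (coneProj n).differentiableAt

theorem pd_comp_coneProj (k : ThIdx n)
    (hg : DifferentiableAt ℝ g (fun E => u (Sum.inr E))) :
    pd k (fun w : ThIdx n → ℝ => g (fun E => w (Sum.inr E))) u
      = fderiv ℝ g (fun E => u (Sum.inr E)) (coneProj n (Pi.single k 1)) := by
  have h := fderiv_comp (f := coneProj n) u hg (coneProj n).differentiableAt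
  rw [(coneProj n).fderiv] at h
  exact congrArg (fun L => L (Pi.single k 1)) h

theorem pd_inl_comp_coneProj (hg : DifferentiableAt ℝ g (fun E => u (Sum.inr E))) :
    pd (Sum.inl ()) (fun w : ThIdx n → ℝ => g (fun E => w (Sum.inr E))) u = 0 := by
  have h : coneProj n (Pi.single (Sum.inl ()) 1) = 0 := by
    ext E; simp [coneProj]
  rw [pd_comp_coneProj _ hg, h, map_zero]

theorem pd_inr_comp_coneProj (A : Fin n)
    (hg : DifferentiableAt ℝ g (fun E => u (Sum.inr E))) :
    pd (Sum.inr A) (fun w : ThIdx n → ℝ => g (fun E => w (Sum.inr E))) u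
      = pd A g (fun E => u (Sum.inr E)) := by
  have h : coneProj n (Pi.single (Sum.inr A) 1) = Pi.single A 1 := by
    ext E; simp [coneProj, Pi.single_apply]
  rw [pd_comp_coneProj _ hg, h, pd]

end ConeProjection

section ConeRescale

variable {n : ℕ} {f : (Fin n → ℝ) → ℝ}

theorem pd_coneRescale_inr (k : ThIdx n) (C : Fin n) (u : ThIdx n → ℝ) :
    pd k (fun w => coneRescale n f w (Sum.inr C)) u = if Sum.inr C = k then 1 else 0 :=
  pd_coord k (Sum.inr C)

theorem differentiableAt_exp_neg_comp_coneProj (hf : Differentiable ℝ f) (u : ThIdx n → ℝ) :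
    DifferentiableAt ℝ (fun w : ThIdx n → ℝ => Real.exp (-f (fun E => w (Sum.inr E)))) u :=
  (differentiableAt_comp_coneProj (hf _)).fun_neg.exp

theorem pd_inl_exp_neg_comp_coneProj (hf : Differentiable ℝ f) (u : ThIdx n → ℝ) :
    pd (Sum.inl ()) (fun w : ThIdx n → ℝ => Real.exp (-f (fun E => w (Sum.inr E)))) u = 0 := by
  rw [pd_exp _ (differentiableAt_comp_coneProj (hf _)).fun_neg, pd_neg, pd_inl_comp_coneProj (hf _)]
  simp

theorem pd_inr_exp_neg_comp_coneProj (hf : Differentiable ℝ f) (A : Fin n) (u : ThIdx n → ℝ) :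
    pd (Sum.inr A) (fun w : ThIdx n → ℝ => Real.exp (-f (fun E => w (Sum.inr E)))) u
      = -(Real.exp (-f (fun E => u (Sum.inr E))) * pd A f (fun E => u (Sum.inr E))) := by
  rw [pd_exp _ (differentiableAt_comp_coneProj (hf _)).fun_neg, pd_neg,
    pd_inr_comp_coneProj _ (hf _), mul_neg]

theorem pd_inl_coneRescale_inl (hf : Differentiable ℝ f) (u : ThIdx n → ℝ) :
    pd (Sum.inl ()) (fun w => coneRescale n f w (Sum.inl ())) u
      = Real.exp (-f (fun E => u (Sum.inr E))) := by
  simp only [coneRescale]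
  rw [pd_mul _ (differentiableAt_exp_neg_comp_coneProj hf u) (by fun_prop),
    pd_inl_exp_neg_comp_coneProj hf, pd_coord]
  simp

theorem pd_inr_coneRescale_inl (hf : Differentiable ℝ f) (A : Fin n) (u : ThIdx n → ℝ) :
    pd (Sum.inr A) (fun w => coneRescale n f w (Sum.inl ())) u
      = -pd A f (fun E => u (Sum.inr E)) * coneRescale n f u (Sum.inl ()) := by
  simp only [coneRescale]
  rw [pd_mul _ (differentiableAt_exp_neg_comp_coneProj hf u) (by fun_prop),
    pd_inr_exp_neg_comp_coneProj hf, pd_coord]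
  simp
  ring

theorem differentiable_coneRescale_inl (hf : Differentiable ℝ f) :
    Differentiable ℝ (fun w => coneRescale n f w (Sum.inl ())) := by
  intro u
  exact (differentiableAt_exp_neg_comp_coneProj hf u).fun_mul (by fun_prop)

theorem pd_inl_neg_pd_mul_coneRescale_inl (hf : ContDiff ℝ (⊤ : ℕ∞) f) (B : Fin n) (u : ThIdx n → ℝ) :
    pd (Sum.inl ()) (fun w => -pd B f (fun E => w (Sum.inr E)) * coneRescale n f w (Sum.inl ())) u
      = -(pd B f (fun E => u (Sum.inr E)) * Real.exp (-f (fun E => u (Sum.inr E)))) := by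
  have hf' : Differentiable ℝ f := hf.differentiable (by simp)
  have hB : Differentiable ℝ (fun y => pd B f y) := (hf.pd_of_top B).differentiable (by simp)
  simp only [neg_mul]
  rw [pd_neg, pd_mul _ (differentiableAt_comp_coneProj (hB _)) (differentiable_coneRescale_inl hf' u),
    pd_inl_comp_coneProj (hB _), pd_inl_coneRescale_inl hf', mul_zero, add_zero]

theorem pd_inr_neg_pd_mul_coneRescale_inl (hf : ContDiff ℝ (⊤ : ℕ∞) f) (A B : Fin n)
    (u : ThIdx n → ℝ) :
    pd (Sum.inr A) (fun w => -pd B f (fun E => w (Sum.inr E)) * coneRescale n f w (Sum.inl ())) u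
      = (pd A f (fun E => u (Sum.inr E)) * pd B f (fun E => u (Sum.inr E))
        - pd A (fun y => pd B f y) (fun E => u (Sum.inr E))) * coneRescale n f u (Sum.inl ()) := by
  have hf' : Differentiable ℝ f := hf.differentiable (by simp)
  have hB : Differentiable ℝ (fun y => pd B f y) := (hf.pd_of_top B).differentiable (by simp)
  simp only [neg_mul]
  rw [pd_neg, pd_mul _ (differentiableAt_comp_coneProj (hB _)) (differentiable_coneRescale_inl hf' u),
    pd_inr_comp_coneProj _ (hB _), pd_inr_coneRescale_inl hf']
  ring

end ConeRescale

/-- The change of the Ricci curvature under a projective change of the connection. -/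
theorem ricConn_projChange (n : ℕ) (Γ : Fin n → Fin n → Fin n → (Fin n → ℝ) → ℝ)
    (hΓ : ∀ C A B, Differentiable ℝ (Γ C A B))
    (hsym : ∀ C A B x, Γ C A B x = Γ C B A x)
    (f : (Fin n → ℝ) → ℝ) (hf : ContDiff ℝ (⊤ : ℕ∞) f) (A B : Fin n) (x : Fin n → ℝ) :
    ricConn (projChange n Γ f) A B x = ricConn Γ A B x
      - ((n : ℝ) - 1) * (pd A (fun y => pd B f y) x - (∑ C, Γ C A B x * pd C f x)
        - pd A f x * pd B f x) := by
  have hd : ∀ C, Differentiable ℝ (fun y => pd C f y) := fun C =>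
    (hf.pd_of_top C).differentiable (by simp)
  have hite : ∀ (p : Prop) [Decidable p] (C : Fin n),
      DifferentiableAt ℝ (fun y => if p then pd C f y else 0) x := by
    intro p _ C
    split_ifs
    · exact hd C x
    · exact differentiableAt_const _
  have hpd : ∀ i C A B, pd i (fun y => projChange n Γ f C A B y) x
      = pd i (fun y => Γ C A B y) x + (if C = A then pd i (fun y => pd B f y) x else 0)
        + (if C = B then pd i (fun y => pd A f y) x else 0) := by
    intro i C A B
    simp only [projChange]
    rw [pd_add i ((hΓ C A B x).fun_add (hite _ _)) (hite _ _), pd_add i (hΓ C A B x) (hite _ _),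
      pd_ite, pd_ite]
  have htrace : ∑ C, Γ C C A x = ∑ C, Γ C A C x :=
    Finset.sum_congr rfl fun C _ => hsym C C A x
  simp only [ricConn, hpd]
  simp only [projChange, add_mul, mul_add, Finset.sum_add_distrib, Finset.sum_sub_distrib,
    mul_ite, ite_mul, mul_zero, zero_mul, Finset.sum_ite_eq, Finset.sum_ite_eq',
    Finset.mem_univ, if_true, Finset.sum_const, Finset.card_univ, Fintype.card_fin,
    nsmul_eq_mul, Finset.sum_ite_irrel, ← Finset.sum_mul, ← Finset.mul_sum]
  rw [pd_comm B A hf]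
  rw [htrace]
  have hcomm : ∑ C, pd C f x * Γ C A B x = ∑ C, Γ C A B x * pd C f x :=
    Finset.sum_congr rfl fun C _ => mul_comm _ _
  rw [hcomm]
  ring

/-- The Thomas cone connection is independent of the choice of
scale: the Thomas cone connections of `Γ` and of the projectively related
connection `Γ'` are related by the diffeomorphism `ψ(x^0,x) = (e^{-f(x)} x^0, x)`. -/
theorem thomas_cone_connection_scale_invariant
    (n : ℕ) (hn : 2 ≤ n) (Γ : Fin n → Fin n → Fin n → (Fin n → ℝ) → ℝ)
    (hsmooth : ∀ C A B, ContDiff ℝ (⊤ : ℕ∞) (Γ C A B))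
    (hsym : ∀ C A B x, Γ C A B x = Γ C B A x)
    (hvol : PreservesVolume n Γ)
    (f : (Fin n → ℝ) → ℝ) (hf : ContDiff ℝ (⊤ : ℕ∞) f) :
    ∀ u : ThIdx n → ℝ, 0 < u (Sum.inl ()) →
      ∀ i j c : ThIdx n,
        (∑ a, ∑ b, thomasConn n (projChange n Γ f) c a b (coneRescale n f u)
            * pd i (fun w => coneRescale n f w a) u
            * pd j (fun w => coneRescale n f w b) u)
          + pd i (fun w => pd j (fun w' => coneRescale n f w' c) w) u
        = ∑ k, thomasConn n Γ k i j u * pd k (fun w => coneRescale n f w c) u := by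
  intro u hu i j c
  have hf' : Differentiable ℝ f := hf.differentiable (by simp)
  have hΓ : ∀ C A B, Differentiable ℝ (Γ C A B) := fun C A B =>
    (hsmooth C A B).differentiable (by simp)
  have hu' : u (Sum.inl ()) ≠ 0 := hu.ne'
  have hn' : (n : ℝ) - 1 ≠ 0 := by
    have : (2 : ℝ) ≤ n := by exact_mod_cast hn
    linarith
  have hbase : (fun E => coneRescale n f u (Sum.inr E)) = fun E => u (Sum.inr E) := rfl
  have hfib : coneRescale n f u (Sum.inl ())
      = Real.exp (-f (fun E => u (Sum.inr E))) * u (Sum.inl ()) := rfl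
  have hexp := Real.exp_ne_zero (-f (fun E => u (Sum.inr E)))
  rcases i with ⟨⟩ | A <;> rcases j with ⟨⟩ | B <;> rcases c with ⟨⟩ | C <;>
  simp [Fintype.sum_sum_type, pd_coneRescale_inr, pd_inl_coneRescale_inl hf',
    pd_inr_coneRescale_inl hf', pd_inl_exp_neg_comp_coneProj hf',
    pd_inr_exp_neg_comp_coneProj hf', pd_inl_neg_pd_mul_coneRescale_inl hf,
    pd_inr_neg_pd_mul_coneRescale_inl hf, pd_const, thomasConn, hbase,
    ricConn_projChange n Γ hΓ hsym f hf, Finset.sum_add_distrib, -neg_mul]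
  · rw [hfib]; field_simp
  · rw [hfib]; field_simp
  · rw [hfib]; field_simp
  · rw [hfib]; field_simp
  · simp only [← mul_assoc, mul_neg, neg_mul, Finset.sum_neg_distrib, ← Finset.sum_mul]
    rw [hfib]
    field_simp
    ring
  · rw [hfib, projChange]
    simp only [eq_comm (a := C)]
    field_simp
    split_ifs <;> ring
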